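/- Let k be a field, (H, c) a cocommutative braided Hopf algebra over k, and (A, s) a left H-module algebra with action ρ. A linear map f : H⊗H → A satisfies the twisted module condition μ_A∘((ρ∘(H⊗ρ))⊗f)∘(H⊗H⊗s²)∘(H⊗c⊗H⊗A)∘(Δ⊗Δ⊗A) = μ_A∘(f⊗(ρ∘(μ⊗A)))∘(H⊗c⊗H⊗A)∘(Δ⊗Δ⊗A) (an equality of maps H⊗H⊗A → A, where s² := (s⊗H)∘(H⊗s) : H⊗H⊗A → A⊗H⊗H; when c and s are the flips this is the classical condition Σ (h₍₁₎·(l₍₁₎·a)) f(h₍₂₎⊗l₍₂₎) = Σ f(h₍₁₎⊗l₍₁₎) ((h₍₂₎l₍₂₎)·a)) if and only if f is s-central, i.e. μ_A∘(A⊗f)∘s² = μ_A∘(f⊗A). -/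

import Mathlib

open TensorProduct LinearMap

noncomputable section

set_option maxHeartbeats 1000000

/-- The data of a braided Hopf algebra structure `(H, c, S)` (on the given algebra and
coalgebra structures of `H`) together with a left `H`-braided module algebra structure
`(A, s, ρ)`. -/
structure ModAlgData (k H A : Type*) [Field k] [Ring H] [Algebra k H] [Coalgebra k H]
    [Ring A] [Algebra k A] where
  /-- the braid of `H` -/
  c : H ⊗[k] H →ₗ[k] H ⊗[k] H
  /-- the antipode of `H` -/
  antipode : H →ₗ[k] H
  /-- the left transposition of `H` on `A` -/
  s : H ⊗[k] A →ₗ[k] A ⊗[k] H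
  /-- the action of `H` on `A` -/
  ρ : H ⊗[k] A →ₗ[k] A
  c_bij : Function.Bijective c
  s_bij : Function.Bijective s
  /-- `Δ(1) = 1⊗1` -/
  comul_one : Coalgebra.comul (R := k) (1 : H) = (1 : H) ⊗ₜ[k] (1 : H)
  /-- `ε(1) = 1` -/
  counit_one : Coalgebra.counit (R := k) (1 : H) = 1
  /-- `ε(hl) = ε(h)ε(l)` -/
  counit_mul : ∀ x y : H, Coalgebra.counit (R := k) (x * y) =
    Coalgebra.counit (R := k) x * Coalgebra.counit (R := k) y
  /-- `c(1⊗h) = h⊗1` -/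
  c_one_left : ∀ h : H, c ((1 : H) ⊗ₜ[k] h) = h ⊗ₜ[k] (1 : H)
  /-- `c(h⊗1) = 1⊗h` -/
  c_one_right : ∀ h : H, c (h ⊗ₜ[k] (1 : H)) = (1 : H) ⊗ₜ[k] h
  /-- `c∘(μ⊗H) = (H⊗μ)∘(c⊗H)∘(H⊗c)` -/
  c_mul_left : c ∘ₗ rTensor H (LinearMap.mul' k H) =
    lTensor H (LinearMap.mul' k H) ∘ₗ (TensorProduct.assoc k H H H).toLinearMap
      ∘ₗ rTensor H c ∘ₗ (TensorProduct.assoc k H H H).symm.toLinearMap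
      ∘ₗ lTensor H c ∘ₗ (TensorProduct.assoc k H H H).toLinearMap
  /-- `c∘(H⊗μ) = (μ⊗H)∘(H⊗c)∘(c⊗H)` -/
  c_mul_right : c ∘ₗ lTensor H (LinearMap.mul' k H) =
    rTensor H (LinearMap.mul' k H) ∘ₗ (TensorProduct.assoc k H H H).symm.toLinearMap
      ∘ₗ lTensor H c ∘ₗ (TensorProduct.assoc k H H H).toLinearMap
      ∘ₗ rTensor H c ∘ₗ (TensorProduct.assoc k H H H).symm.toLinearMap
  /-- `(H⊗Δ)∘c = (c⊗H)∘(H⊗c)∘(Δ⊗H)` -/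
  c_comul_left : lTensor H (Coalgebra.comul (R := k)) ∘ₗ c =
    (TensorProduct.assoc k H H H).toLinearMap ∘ₗ rTensor H c
      ∘ₗ (TensorProduct.assoc k H H H).symm.toLinearMap ∘ₗ lTensor H c
      ∘ₗ (TensorProduct.assoc k H H H).toLinearMap ∘ₗ rTensor H (Coalgebra.comul (R := k))
  /-- `(Δ⊗H)∘c = (H⊗c)∘(c⊗H)∘(H⊗Δ)` -/
  c_comul_right : rTensor H (Coalgebra.comul (R := k)) ∘ₗ c =
    (TensorProduct.assoc k H H H).symm.toLinearMap ∘ₗ lTensor H c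
      ∘ₗ (TensorProduct.assoc k H H H).toLinearMap ∘ₗ rTensor H c
      ∘ₗ (TensorProduct.assoc k H H H).symm.toLinearMap ∘ₗ lTensor H (Coalgebra.comul (R := k))
  /-- `(H⊗ε)∘c = ε⊗H` -/
  c_counit_left : (TensorProduct.rid k H).toLinearMap
      ∘ₗ lTensor H (Coalgebra.counit (R := k)) ∘ₗ c =
    (TensorProduct.lid k H).toLinearMap ∘ₗ rTensor H (Coalgebra.counit (R := k))
  /-- `(ε⊗H)∘c = H⊗ε` -/
  c_counit_right : (TensorProduct.lid k H).toLinearMap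
      ∘ₗ rTensor H (Coalgebra.counit (R := k)) ∘ₗ c =
    (TensorProduct.rid k H).toLinearMap ∘ₗ lTensor H (Coalgebra.counit (R := k))
  /-- `Δ∘μ = (μ⊗μ)∘(H⊗c⊗H)∘(Δ⊗Δ)` -/
  comul_mul : Coalgebra.comul (R := k) ∘ₗ LinearMap.mul' k H =
    TensorProduct.map (LinearMap.mul' k H) (LinearMap.mul' k H)
      ∘ₗ (TensorProduct.assoc k H H (H ⊗[k] H)).symm.toLinearMap
      ∘ₗ lTensor H ((TensorProduct.assoc k H H H).toLinearMap ∘ₗ rTensor H c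
          ∘ₗ (TensorProduct.assoc k H H H).symm.toLinearMap)
      ∘ₗ (TensorProduct.assoc k H H (H ⊗[k] H)).toLinearMap
      ∘ₗ TensorProduct.map (Coalgebra.comul (R := k)) (Coalgebra.comul (R := k))
  /-- `μ∘(S⊗H)∘Δ = η∘ε` -/
  antipode_left : LinearMap.mul' k H ∘ₗ rTensor H antipode ∘ₗ Coalgebra.comul (R := k) =
    Algebra.linearMap k H ∘ₗ Coalgebra.counit (R := k)
  /-- `μ∘(H⊗S)∘Δ = η∘ε` -/
  antipode_right : LinearMap.mul' k H ∘ₗ lTensor H antipode ∘ₗ Coalgebra.comul (R := k) =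
    Algebra.linearMap k H ∘ₗ Coalgebra.counit (R := k)
  /-- `s(1⊗a) = a⊗1` -/
  s_one_left : ∀ a : A, s ((1 : H) ⊗ₜ[k] a) = a ⊗ₜ[k] (1 : H)
  /-- `s(h⊗1) = 1⊗h` -/
  s_one_right : ∀ h : H, s (h ⊗ₜ[k] (1 : A)) = (1 : A) ⊗ₜ[k] h
  /-- `s∘(μ⊗A) = (A⊗μ)∘(s⊗H)∘(H⊗s)` -/
  s_mul_H : s ∘ₗ rTensor A (LinearMap.mul' k H) =
    lTensor A (LinearMap.mul' k H) ∘ₗ (TensorProduct.assoc k A H H).toLinearMap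
      ∘ₗ rTensor H s ∘ₗ (TensorProduct.assoc k H A H).symm.toLinearMap
      ∘ₗ lTensor H s ∘ₗ (TensorProduct.assoc k H H A).toLinearMap
  /-- `(A⊗ε)∘s = ε⊗A` -/
  s_counit : (TensorProduct.rid k A).toLinearMap
      ∘ₗ lTensor A (Coalgebra.counit (R := k)) ∘ₗ s =
    (TensorProduct.lid k A).toLinearMap ∘ₗ rTensor A (Coalgebra.counit (R := k))
  /-- `(A⊗Δ)∘s = (s⊗H)∘(H⊗s)∘(Δ⊗A)` -/
  s_comul : lTensor A (Coalgebra.comul (R := k)) ∘ₗ s =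
    (TensorProduct.assoc k A H H).toLinearMap ∘ₗ rTensor H s
      ∘ₗ (TensorProduct.assoc k H A H).symm.toLinearMap ∘ₗ lTensor H s
      ∘ₗ (TensorProduct.assoc k H H A).toLinearMap ∘ₗ rTensor A (Coalgebra.comul (R := k))
  /-- `(s⊗H)∘(H⊗s)∘(c⊗A) = (A⊗c)∘(s⊗H)∘(H⊗s)` -/
  s_braid : (TensorProduct.assoc k A H H).toLinearMap ∘ₗ rTensor H s
      ∘ₗ (TensorProduct.assoc k H A H).symm.toLinearMap ∘ₗ lTensor H s
      ∘ₗ (TensorProduct.assoc k H H A).toLinearMap ∘ₗ rTensor A c =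
    lTensor A c ∘ₗ (TensorProduct.assoc k A H H).toLinearMap ∘ₗ rTensor H s
      ∘ₗ (TensorProduct.assoc k H A H).symm.toLinearMap ∘ₗ lTensor H s
      ∘ₗ (TensorProduct.assoc k H H A).toLinearMap
  /-- `s∘(H⊗μ_A) = (μ_A⊗H)∘(A⊗s)∘(s⊗A)` -/
  s_mul_A : s ∘ₗ lTensor H (LinearMap.mul' k A) =
    rTensor H (LinearMap.mul' k A) ∘ₗ (TensorProduct.assoc k A A H).symm.toLinearMap
      ∘ₗ lTensor A s ∘ₗ (TensorProduct.assoc k A H A).toLinearMap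
      ∘ₗ rTensor A s ∘ₗ (TensorProduct.assoc k H A A).symm.toLinearMap
  /-- `ρ(1⊗a) = a` -/
  ρ_one : ∀ a : A, ρ ((1 : H) ⊗ₜ[k] a) = a
  /-- `ρ∘(μ⊗A) = ρ∘(H⊗ρ)` -/
  ρ_mul : ρ ∘ₗ rTensor A (LinearMap.mul' k H) =
    ρ ∘ₗ lTensor H ρ ∘ₗ (TensorProduct.assoc k H H A).toLinearMap
  /-- `s∘(H⊗ρ) = (ρ⊗H)∘(H⊗s)∘(c⊗A)` -/
  s_ρ : s ∘ₗ lTensor H ρ =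
    rTensor H ρ ∘ₗ (TensorProduct.assoc k H A H).symm.toLinearMap ∘ₗ lTensor H s
      ∘ₗ (TensorProduct.assoc k H H A).toLinearMap ∘ₗ rTensor A c
      ∘ₗ (TensorProduct.assoc k H H A).symm.toLinearMap
  /-- `ρ∘(H⊗μ_A) = μ_A∘(ρ⊗ρ)∘(H⊗s⊗A)∘(Δ⊗A⊗A)` -/
  ρ_mul_A : ρ ∘ₗ lTensor H (LinearMap.mul' k A) =
    LinearMap.mul' k A ∘ₗ TensorProduct.map ρ ρ
      ∘ₗ (TensorProduct.assoc k H A (H ⊗[k] A)).symm.toLinearMap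
      ∘ₗ lTensor H ((TensorProduct.assoc k A H A).toLinearMap ∘ₗ rTensor A s
          ∘ₗ (TensorProduct.assoc k H A A).symm.toLinearMap)
      ∘ₗ (TensorProduct.assoc k H H (A ⊗[k] A)).toLinearMap
      ∘ₗ rTensor (A ⊗[k] A) (Coalgebra.comul (R := k))
  /-- `ρ(h⊗1) = ε(h)1` -/
  ρ_unit : ∀ h : H, ρ (h ⊗ₜ[k] (1 : A)) = Coalgebra.counit (R := k) h • (1 : A)

variable {k H A : Type*} [Field k] [Ring H] [Algebra k H] [Coalgebra k H]
  [Ring A] [Algebra k A]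

/-- `(H, c)` is cocommutative: `c∘c = id` and `c∘Δ = Δ`. -/
def ModAlgData.Cocomm (D : ModAlgData k H A) : Prop :=
  D.c ∘ₗ D.c = LinearMap.id ∧
    D.c ∘ₗ Coalgebra.comul (R := k) = Coalgebra.comul (R := k)

/-- The convolution product on `Hom_k(H, A)`. -/
def conv1 (f g : H →ₗ[k] A) : H →ₗ[k] A :=
  LinearMap.mul' k A ∘ₗ TensorProduct.map f g ∘ₗ Coalgebra.comul (R := k)

/-- The convolution unit `η_A∘ε` on `Hom_k(H, A)`. -/
def unit1 : H →ₗ[k] A :=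
  Algebra.linearMap k A ∘ₗ Coalgebra.counit (R := k)

/-- The map `χ := (ρ⊗H)∘(H⊗s)∘(Δ⊗A) : H⊗A → A⊗H`. -/
def ModAlgData.χ (D : ModAlgData k H A) : H ⊗[k] A →ₗ[k] A ⊗[k] H :=
  rTensor H D.ρ ∘ₗ (TensorProduct.assoc k H A H).symm.toLinearMap ∘ₗ lTensor H D.s
    ∘ₗ (TensorProduct.assoc k H H A).toLinearMap
    ∘ₗ rTensor A (Coalgebra.comul (R := k))

/-- `s² := (s⊗H)∘(H⊗s) : (H⊗H)⊗A → A⊗(H⊗H)`. -/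
def ModAlgData.s2 (D : ModAlgData k H A) : (H ⊗[k] H) ⊗[k] A →ₗ[k] A ⊗[k] (H ⊗[k] H) :=
  (TensorProduct.assoc k A H H).toLinearMap ∘ₗ rTensor H D.s
    ∘ₗ (TensorProduct.assoc k H A H).symm.toLinearMap ∘ₗ lTensor H D.s
    ∘ₗ (TensorProduct.assoc k H H A).toLinearMap

/-- The middle braid `H⊗c⊗H : (H⊗H)⊗(H⊗H) → (H⊗H)⊗(H⊗H)`. -/
def ModAlgData.mid4 (D : ModAlgData k H A) :
    (H ⊗[k] H) ⊗[k] (H ⊗[k] H) →ₗ[k] (H ⊗[k] H) ⊗[k] (H ⊗[k] H) :=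
  (TensorProduct.assoc k H H (H ⊗[k] H)).symm.toLinearMap
    ∘ₗ lTensor H ((TensorProduct.assoc k H H H).toLinearMap ∘ₗ rTensor H D.c
        ∘ₗ (TensorProduct.assoc k H H H).symm.toLinearMap)
    ∘ₗ (TensorProduct.assoc k H H (H ⊗[k] H)).toLinearMap

namespace ModAlgData

/-- `(ρ⊗H)∘(H⊗s) : (H⊗H)⊗A → A⊗H`. -/
def actSwap (D : ModAlgData k H A) : (H ⊗[k] H) ⊗[k] A →ₗ[k] A ⊗[k] H :=
  rTensor H D.ρ ∘ₗ (TensorProduct.assoc k H A H).symm.toLinearMap ∘ₗ lTensor H D.s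
    ∘ₗ (TensorProduct.assoc k H H A).toLinearMap

/-- `(H⊗ρ)∘(Δ⊗A) : H⊗A → H⊗A`. -/
def coact (D : ModAlgData k H A) : H ⊗[k] A →ₗ[k] H ⊗[k] A :=
  lTensor H D.ρ ∘ₗ (TensorProduct.assoc k H H A).toLinearMap
    ∘ₗ rTensor A (Coalgebra.comul (R := k))

/-- `(H⊗H⊗ρ)∘(H⊗c⊗A)∘(Δ⊗H⊗A) : H⊗H⊗A → H⊗H⊗A`. -/
def braidedCoact (D : ModAlgData k H A) : H ⊗[k] (H ⊗[k] A) →ₗ[k] H ⊗[k] (H ⊗[k] A) :=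
  lTensor H (lTensor H D.ρ ∘ₗ (TensorProduct.assoc k H H A).toLinearMap ∘ₗ rTensor A D.c
      ∘ₗ (TensorProduct.assoc k H H A).symm.toLinearMap)
    ∘ₗ (TensorProduct.assoc k H H (H ⊗[k] A)).toLinearMap
    ∘ₗ rTensor (H ⊗[k] A) (Coalgebra.comul (R := k))

/-- `(H⊗H⊗ρ(μ⊗A))∘(H⊗c⊗H⊗A)∘(Δ⊗Δ⊗A) : H⊗H⊗A → H⊗H⊗A`. -/
def coact2 (D : ModAlgData k H A) : (H ⊗[k] H) ⊗[k] A →ₗ[k] (H ⊗[k] H) ⊗[k] A :=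
  lTensor (H ⊗[k] H) (D.ρ ∘ₗ rTensor A (LinearMap.mul' k H))
    ∘ₗ (TensorProduct.assoc k (H ⊗[k] H) (H ⊗[k] H) A).toLinearMap
    ∘ₗ rTensor A D.mid4
    ∘ₗ rTensor A (TensorProduct.map (Coalgebra.comul (R := k)) (Coalgebra.comul (R := k)))

/-- `(ρ(H⊗ρ)⊗H⊗H)∘(H⊗H⊗s²)∘(H⊗c⊗H⊗A)∘(Δ⊗Δ⊗A)`. -/
def χ2 (D : ModAlgData k H A) : (H ⊗[k] H) ⊗[k] A →ₗ[k] A ⊗[k] (H ⊗[k] H) :=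
  rTensor (H ⊗[k] H) (D.ρ ∘ₗ lTensor H D.ρ ∘ₗ (TensorProduct.assoc k H H A).toLinearMap)
    ∘ₗ (TensorProduct.assoc k (H ⊗[k] H) A (H ⊗[k] H)).symm.toLinearMap
    ∘ₗ lTensor (H ⊗[k] H) D.s2
    ∘ₗ (TensorProduct.assoc k (H ⊗[k] H) (H ⊗[k] H) A).toLinearMap
    ∘ₗ rTensor A D.mid4
    ∘ₗ rTensor A (TensorProduct.map (Coalgebra.comul (R := k)) (Coalgebra.comul (R := k)))

/-- `χ⊗H` on the right-nested tensor products. -/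
def χTensor (D : ModAlgData k H A) : H ⊗[k] (A ⊗[k] H) →ₗ[k] A ⊗[k] (H ⊗[k] H) :=
  (TensorProduct.assoc k A H H).toLinearMap ∘ₗ rTensor H D.χ
    ∘ₗ (TensorProduct.assoc k H A H).symm.toLinearMap

variable (D : ModAlgData k H A)

theorem s_ρ_apply (y u : H) (b : A) :
    D.s (y ⊗ₜ D.ρ (u ⊗ₜ b)) = D.actSwap (D.c (y ⊗ₜ u) ⊗ₜ b) :=
  LinearMap.congr_fun D.s_ρ (y ⊗ₜ[k] (u ⊗ₜ[k] b))

theorem actSwap_comp_c :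
    D.actSwap ∘ₗ rTensor A D.c =
      D.s ∘ₗ lTensor H D.ρ ∘ₗ (TensorProduct.assoc k H H A).toLinearMap := by
  ext y u b
  exact (D.s_ρ_apply y u b).symm

theorem ρ_mul_apply (x y : H) (a : A) : D.ρ ((x * y) ⊗ₜ a) = D.ρ (x ⊗ₜ D.ρ (y ⊗ₜ a)) :=
  LinearMap.congr_fun D.ρ_mul ((x ⊗ₜ[k] y) ⊗ₜ[k] a)

theorem s_comp_coact (hcc : D.Cocomm) : D.s ∘ₗ D.coact = D.χ := by
  have h : D.s ∘ₗ D.coact =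
      D.actSwap ∘ₗ rTensor A (D.c ∘ₗ Coalgebra.comul (R := k)) := by
    rw [rTensor_comp, ← LinearMap.comp_assoc, actSwap_comp_c]
    rfl
  rw [h, hcc.2]
  rfl

theorem coact_surjective : Function.Surjective D.coact := by
  have h : D.coact ∘ₗ (lTensor H (D.ρ ∘ₗ rTensor A D.antipode)
      ∘ₗ (TensorProduct.assoc k H H A).toLinearMap
      ∘ₗ rTensor A (Coalgebra.comul (R := k))) = LinearMap.id := by
    ext h a
    have key : ∀ t : H ⊗[k] H,
        D.coact (lTensor H (D.ρ ∘ₗ rTensor A D.antipode)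
          (TensorProduct.assoc k H H A (t ⊗ₜ a))) =
        lTensor H ((D.ρ ∘ₗ (TensorProduct.mk k H A).flip a)
            ∘ₗ LinearMap.mul' k H ∘ₗ lTensor H D.antipode)
          (TensorProduct.assoc k H H H (rTensor H (Coalgebra.comul (R := k)) t)) := by
      intro t
      induction t with
      | zero => simp
      | add t t' ht ht' => simp only [add_tmul, map_add, ht, ht']
      | tmul x y =>
        simp only [coact, LinearMap.comp_apply, LinearEquiv.coe_coe, assoc_tmul, lTensor_tmul,
          rTensor_tmul]
        generalize Coalgebra.comul (R := k) x = t
        induction t with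
        | zero => simp
        | add t t' ht ht' => simp only [add_tmul, map_add, ht, ht']
        | tmul u v => simp [ρ_mul_apply]
    have h1 : (D.ρ ∘ₗ (TensorProduct.mk k H A).flip a)
            ∘ₗ LinearMap.mul' k H ∘ₗ lTensor H D.antipode ∘ₗ Coalgebra.comul (R := k) =
          (LinearMap.toSpanSingleton k A a) ∘ₗ Coalgebra.counit (R := k) := by
      rw [D.antipode_right]
      ext x
      simp [Algebra.algebraMap_eq_smul_one, D.ρ_one]
    simp only [AlgebraTensorModule.curry_apply, curry_apply, LinearMap.coe_restrictScalars,
      LinearMap.comp_apply, LinearEquiv.coe_coe, rTensor_tmul, LinearMap.id_apply]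
    rw [key, Coalgebra.coassoc_apply, ← LinearMap.comp_apply, ← lTensor_comp]
    simp only [LinearMap.comp_assoc] at h1 ⊢
    rw [h1, lTensor_comp, LinearMap.comp_apply, Coalgebra.lTensor_counit_comul]
    simp
  exact fun z => ⟨_, LinearMap.congr_fun h z⟩

theorem c_comp_braidedCoact :
    rTensor A D.c ∘ₗ (TensorProduct.assoc k H H A).symm.toLinearMap ∘ₗ D.braidedCoact =
      (TensorProduct.assoc k H H A).symm.toLinearMap ∘ₗ lTensor H D.coact
        ∘ₗ (TensorProduct.assoc k H H A).toLinearMap ∘ₗ rTensor A D.c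
        ∘ₗ (TensorProduct.assoc k H H A).symm.toLinearMap := by
  ext h l a
  have hc := LinearMap.congr_fun D.c_comul_left (h ⊗ₜ[k] l)
  have hr : ∀ t : H ⊗[k] H, lTensor H D.coact (TensorProduct.assoc k H H A (t ⊗ₜ a)) =
      lTensor H (lTensor H (D.ρ ∘ₗ (TensorProduct.mk k H A).flip a))
        (lTensor H (Coalgebra.comul (R := k)) t) := by
    intro t
    induction t with
    | zero => simp
    | add t t' ht ht' => simp only [add_tmul, map_add, ht, ht']
    | tmul x y =>
      simp only [coact, LinearMap.comp_apply, LinearEquiv.coe_coe, assoc_tmul, lTensor_tmul,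
        rTensor_tmul]
      generalize Coalgebra.comul (R := k) y = t
      induction t with
      | zero => simp
      | add t t' ht ht' => simp only [add_tmul, tmul_add, map_add, ht, ht']
      | tmul u v => simp
  simp only [LinearMap.comp_apply] at hc
  simp only [AlgebraTensorModule.curry_apply, curry_apply, LinearMap.coe_restrictScalars,
    LinearMap.comp_apply, LinearEquiv.coe_coe, rTensor_tmul, assoc_symm_tmul, hr, hc,
    braidedCoact]
  generalize Coalgebra.comul (R := k) h = t
  induction t with
  | zero => simp
  | add t t' ht ht' => simp only [add_tmul, map_add, ht, ht']
  | tmul x y =>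
    simp only [LinearMap.comp_apply, LinearEquiv.coe_coe, assoc_tmul, lTensor_tmul,
      rTensor_tmul, assoc_symm_tmul]
    generalize D.c (y ⊗ₜ l) = t
    induction t with
    | zero => simp
    | add t t' ht ht' => simp only [add_tmul, tmul_add, map_add, ht, ht']
    | tmul u v =>
      simp only [assoc_tmul, lTensor_tmul, rTensor_tmul, assoc_symm_tmul]
      generalize D.c (x ⊗ₜ u) = t
      induction t with
      | zero => simp
      | add t t' ht ht' => simp only [add_tmul, map_add, ht, ht']
      | tmul p q => simp

theorem braidedCoact_surjective : Function.Surjective D.braidedCoact := by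
  have hinj : Function.Injective
      (rTensor A D.c ∘ₗ (TensorProduct.assoc k H H A).symm.toLinearMap) := by
    rw [LinearMap.coe_comp]
    exact (LinearEquiv.rTensor A (LinearEquiv.ofBijective D.c D.c_bij)).injective.comp
      (TensorProduct.assoc k H H A).symm.injective
  have hsurj : Function.Surjective
      ((TensorProduct.assoc k H H A).symm.toLinearMap ∘ₗ lTensor H D.coact
        ∘ₗ (TensorProduct.assoc k H H A).toLinearMap ∘ₗ rTensor A D.c
        ∘ₗ (TensorProduct.assoc k H H A).symm.toLinearMap) := by
    simp only [LinearMap.coe_comp]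
    exact (TensorProduct.assoc k H H A).symm.surjective.comp
      ((lTensor_surjective H D.coact_surjective).comp
        ((TensorProduct.assoc k H H A).surjective.comp
          ((rTensor_surjective A D.c_bij.surjective).comp
            (TensorProduct.assoc k H H A).symm.surjective)))
  rw [← c_comp_braidedCoact] at hsurj
  intro z
  obtain ⟨w, hw⟩ := hsurj
    ((rTensor A D.c ∘ₗ (TensorProduct.assoc k H H A).symm.toLinearMap) z)
  exact ⟨w, hinj hw⟩

theorem coact2_eq :
    D.coact2 = (TensorProduct.assoc k H H A).symm.toLinearMap ∘ₗ D.braidedCoact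
      ∘ₗ lTensor H D.coact ∘ₗ (TensorProduct.assoc k H H A).toLinearMap := by
  ext h l a
  simp only [AlgebraTensorModule.curry_apply, curry_apply, LinearMap.coe_restrictScalars,
    LinearMap.comp_apply, LinearEquiv.coe_coe, rTensor_tmul, assoc_tmul, lTensor_tmul, map_tmul,
    coact2, coact, mid4, braidedCoact]
  generalize Coalgebra.comul (R := k) h = t
  generalize Coalgebra.comul (R := k) l = t'
  induction t with
  | zero => simp
  | add _ _ h₁ h₂ => simp only [add_tmul, map_add, h₁, h₂]
  | tmul x y =>
    induction t' with
    | zero => simp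
    | add _ _ h₁ h₂ => simp only [add_tmul, tmul_add, map_add, h₁, h₂]
    | tmul u v =>
      simp only [LinearMap.comp_apply, LinearEquiv.coe_coe, assoc_tmul, lTensor_tmul,
        rTensor_tmul, assoc_symm_tmul]
      generalize D.c (y ⊗ₜ u) = t
      induction t with
      | zero => simp
      | add _ _ h₁ h₂ => simp only [add_tmul, tmul_add, map_add, h₁, h₂]
      | tmul p q => simp [ρ_mul_apply]

theorem coact2_surjective : Function.Surjective D.coact2 := by
  rw [coact2_eq]
  simp only [LinearMap.coe_comp]
  exact (TensorProduct.assoc k H H A).symm.surjective.comp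
    (D.braidedCoact_surjective.comp ((lTensor_surjective H D.coact_surjective).comp
      (TensorProduct.assoc k H H A).surjective))

theorem χ2_eq :
    D.χ2 = D.χTensor ∘ₗ lTensor H D.χ ∘ₗ (TensorProduct.assoc k H H A).toLinearMap := by
  ext h l a
  simp only [AlgebraTensorModule.curry_apply, curry_apply, LinearMap.coe_restrictScalars,
    LinearMap.comp_apply, LinearEquiv.coe_coe, rTensor_tmul, assoc_tmul, lTensor_tmul, map_tmul,
    χ2, χTensor, mid4, s2]
  rw [show D.χ (l ⊗ₜ a) = D.actSwap (Coalgebra.comul (R := k) l ⊗ₜ a) from rfl]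
  generalize Coalgebra.comul (R := k) l = t'
  induction t' with
  | zero => simp
  | add _ _ h₁ h₂ => simp only [add_tmul, tmul_add, map_add, h₁, h₂]
  | tmul u v =>
    rw [show D.actSwap ((u ⊗ₜ v) ⊗ₜ a) = rTensor H D.ρ
      ((TensorProduct.assoc k H A H).symm (u ⊗ₜ D.s (v ⊗ₜ a))) from rfl]
    have hz : ∀ z : A ⊗[k] H, rTensor H D.χ ((TensorProduct.assoc k H A H).symm
        (h ⊗ₜ rTensor H D.ρ ((TensorProduct.assoc k H A H).symm (u ⊗ₜ z)))) =
        rTensor H (D.actSwap ∘ₗ TensorProduct.mk k (H ⊗[k] H) A (Coalgebra.comul (R := k) h)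
          ∘ₗ D.ρ ∘ₗ TensorProduct.mk k H A u) z := by
      intro z
      induction z with
      | zero => simp
      | add _ _ h₁ h₂ => simp only [tmul_add, map_add, h₁, h₂]
      | tmul b w => rfl
    rw [hz]
    generalize Coalgebra.comul (R := k) h = t
    induction t with
    | zero => simp
    | add _ _ h₁ h₂ =>
      simp only [add_tmul, map_add, h₁, h₂, LinearMap.comp_add, LinearMap.add_comp,
        rTensor_add, LinearMap.add_apply]
    | tmul x y =>
      simp only [LinearMap.comp_apply, LinearEquiv.coe_coe, assoc_tmul, lTensor_tmul,
        rTensor_tmul, assoc_symm_tmul]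
      have hb : D.actSwap ∘ₗ TensorProduct.mk k (H ⊗[k] H) A (x ⊗ₜ y)
          ∘ₗ D.ρ ∘ₗ TensorProduct.mk k H A u =
          rTensor H (D.ρ ∘ₗ TensorProduct.mk k H A x) ∘ₗ D.actSwap
            ∘ₗ TensorProduct.mk k (H ⊗[k] H) A (D.c (y ⊗ₜ u)) := by
        ext b
        simp only [LinearMap.comp_apply, mk_apply]
        rw [← s_ρ_apply, rTensor_comp, LinearMap.comp_apply]
        simp only [actSwap, LinearMap.comp_apply, LinearEquiv.coe_coe, assoc_tmul, lTensor_tmul]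
        rfl
      rw [hb]
      generalize D.c (y ⊗ₜ u) = t
      induction t with
      | zero => simp
      | add _ _ h₁ h₂ =>
        simp only [add_tmul, tmul_add, map_add, h₁, h₂, LinearMap.comp_add,
          rTensor_add, LinearMap.add_apply]
      | tmul p q =>
        simp only [LinearMap.comp_apply, LinearEquiv.coe_coe, assoc_tmul, lTensor_tmul,
          assoc_symm_tmul]
        generalize D.s (v ⊗ₜ a) = z
        induction z with
        | zero => simp
        | add _ _ h₁ h₂ => simp only [tmul_add, map_add, h₁, h₂]
        | tmul b w =>
          simp only [LinearMap.comp_apply, LinearEquiv.coe_coe, assoc_tmul, lTensor_tmul,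
            rTensor_tmul, assoc_symm_tmul, actSwap, mk_apply]
          generalize D.s (q ⊗ₜ b) = z
          induction z with
          | zero => simp
          | add _ _ h₁ h₂ => simp only [add_tmul, tmul_add, map_add, h₁, h₂]
          | tmul e r => simp

theorem s2_comp_braidedCoact (hcc : D.Cocomm) :
    D.s2 ∘ₗ (TensorProduct.assoc k H H A).symm.toLinearMap ∘ₗ D.braidedCoact =
      D.χTensor ∘ₗ lTensor H D.s := by
  ext h l a
  have hχ : ∀ z : A ⊗[k] H, D.χTensor (h ⊗ₜ z) =
      TensorProduct.assoc k A H H (rTensor H D.s ((TensorProduct.assoc k H A H).symm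
        (lTensor H (rTensor H D.ρ ∘ₗ (TensorProduct.assoc k H A H).symm.toLinearMap)
          (TensorProduct.assoc k H H (A ⊗[k] H) (Coalgebra.comul (R := k) h ⊗ₜ z))))) := by
    intro z
    induction z with
    | zero => simp
    | add _ _ h₁ h₂ => simp only [tmul_add, map_add, h₁, h₂]
    | tmul b w =>
      simp only [χTensor, ← s_comp_coact D hcc, coact, LinearMap.comp_apply,
        LinearEquiv.coe_coe, assoc_symm_tmul, rTensor_tmul]
      generalize Coalgebra.comul (R := k) h = t
      induction t with
      | zero => simp
      | add _ _ h₁ h₂ => simp only [add_tmul, map_add, h₁, h₂]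
      | tmul x y => simp
  have hs : ∀ t : H ⊗[k] H, D.s (lTensor H D.ρ (TensorProduct.assoc k H H A (t ⊗ₜ a))) =
      D.actSwap (D.c t ⊗ₜ a) :=
    fun t => (LinearMap.congr_fun D.actSwap_comp_c (t ⊗ₜ a)).symm
  simp only [AlgebraTensorModule.curry_apply, curry_apply, LinearMap.coe_restrictScalars,
    LinearMap.comp_apply, LinearEquiv.coe_coe, rTensor_tmul, lTensor_tmul, hχ, braidedCoact, s2,
    LinearEquiv.apply_symm_apply]
  congr 3
  generalize Coalgebra.comul (R := k) h = t
  induction t with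
  | zero => simp
  | add _ _ h₁ h₂ => simp only [add_tmul, map_add, h₁, h₂]
  | tmul x y =>
    simp only [LinearMap.comp_apply, LinearEquiv.coe_coe, assoc_tmul, lTensor_tmul,
      rTensor_tmul, assoc_symm_tmul, hs]
    rw [← LinearMap.comp_apply D.c D.c, hcc.1]
    rfl

theorem s2_comp_coact2 (hcc : D.Cocomm) : D.s2 ∘ₗ D.coact2 = D.χ2 := by
  rw [coact2_eq, χ2_eq, ← s_comp_coact D hcc, lTensor_comp]
  simp only [← LinearMap.comp_assoc]
  congr 2
  rw [← s2_comp_braidedCoact D hcc, LinearMap.comp_assoc]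

end ModAlgData

/-- Proposition 3.4: for a cocommutative braided Hopf algebra `H` and a left
`H`-module algebra `(A, s)`, a map `f : H⊗H → A` satisfies the twisted module condition iff
it is `s`-central. -/
theorem twisted_module_condition_iff_s_central
    (D : ModAlgData k H A) (hcc : D.Cocomm)
    (f : H ⊗[k] H →ₗ[k] A) :
    (LinearMap.mul' k A
        ∘ₗ TensorProduct.map
            (D.ρ ∘ₗ lTensor H D.ρ ∘ₗ (TensorProduct.assoc k H H A).toLinearMap) f
        ∘ₗ (TensorProduct.assoc k (H ⊗[k] H) A (H ⊗[k] H)).symm.toLinearMap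
        ∘ₗ lTensor (H ⊗[k] H) D.s2
        ∘ₗ (TensorProduct.assoc k (H ⊗[k] H) (H ⊗[k] H) A).toLinearMap
        ∘ₗ rTensor A D.mid4
        ∘ₗ rTensor A (TensorProduct.map (Coalgebra.comul (R := k)) (Coalgebra.comul (R := k))) =
      LinearMap.mul' k A
        ∘ₗ TensorProduct.map f (D.ρ ∘ₗ rTensor A (LinearMap.mul' k H))
        ∘ₗ (TensorProduct.assoc k (H ⊗[k] H) (H ⊗[k] H) A).toLinearMap
        ∘ₗ rTensor A D.mid4
        ∘ₗ rTensor A (TensorProduct.map (Coalgebra.comul (R := k)) (Coalgebra.comul (R := k)))) ↔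
      LinearMap.mul' k A ∘ₗ lTensor A f ∘ₗ D.s2 = LinearMap.mul' k A ∘ₗ rTensor A f := by
  have hl : TensorProduct.map
      (D.ρ ∘ₗ lTensor H D.ρ ∘ₗ (TensorProduct.assoc k H H A).toLinearMap) f =
      lTensor A f ∘ₗ rTensor (H ⊗[k] H)
        (D.ρ ∘ₗ lTensor H D.ρ ∘ₗ (TensorProduct.assoc k H H A).toLinearMap) :=
    (lTensor_comp_rTensor _ _ _).symm
  have hr : TensorProduct.map f (D.ρ ∘ₗ rTensor A (LinearMap.mul' k H)) =
      rTensor A f ∘ₗ lTensor (H ⊗[k] H) (D.ρ ∘ₗ rTensor A (LinearMap.mul' k H)) :=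
    (rTensor_comp_lTensor _ _ _).symm
  rw [hl, hr]
  change (LinearMap.mul' k A ∘ₗ lTensor A f) ∘ₗ D.χ2 =
    (LinearMap.mul' k A ∘ₗ rTensor A f) ∘ₗ D.coact2 ↔ _
  rw [← D.s2_comp_coact2 hcc, ← LinearMap.comp_assoc, LinearMap.cancel_right D.coact2_surjective,
    LinearMap.comp_assoc]
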